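/- arXiv:2605.10421 — 4 statements merged into one kernel-verified Lean document; each statement's English description precedes it below -/
import Mathlib

section
/- Let S, S̄ : [0,∞) → B(E) both satisfy the operator-norm bound ‖S(t)‖ ≤ 1, ‖S̄(t)‖ ≤ 1 and strong continuity, and let ε > 0, η > 0 be such that ∫₀ᵗ ‖S(τ) − S̄(τ)‖ dτ ≤ ε e^{η t} for all t ≥ 0. Let φ, φ̄ : [0,∞) → E be bounded continuous with M̄ := sup_{t≥0} ‖φ̄(t)‖, and let u, ū : [0,∞) → E be continuous functions satisfying u(t) = φ(t) + ∫₀ᵗ S(t−s) f(u(s)) ds and ū(t) = φ̄(t) + ∫₀ᵗ S̄(t−s) f(ū(s)) ds for all t ≥ 0. Then for every t ≥ 0, ‖u(t) − ū(t)‖ ≤ ( sup_{s∈[0,t]} ‖φ(s) − φ̄(s)‖ + L M̄ ε e^{(L+η) t} ) e^{L t}. -/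
open MeasureTheory Set

/-- Integral form of Grönwall's inequality with constant coefficients. -/
theorem le_mul_exp_of_le_add_mul_integral {g : ℝ → ℝ} {a L T : ℝ}
    (hg : ContinuousOn g (Ici 0)) (hL : 0 ≤ L) (hT : 0 ≤ T)
    (h : ∀ t ∈ Icc 0 T, g t ≤ a + L * ∫ s in (0:ℝ)..t, g s) :
    g T ≤ a * Real.exp (L * T) := by
  set k : ℝ → ℝ := fun t => g (max 0 t) with hk
  have hkc : Continuous k := hg.comp_continuous (by fun_prop) fun x => le_max_left 0 x
  have hkg : ∀ t ≥ (0:ℝ), ∫ s in (0:ℝ)..t, k s = ∫ s in (0:ℝ)..t, g s := fun t ht =>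
    intervalIntegral.integral_congr fun s hs => by
      rw [uIcc_of_le ht] at hs
      simp [hk, max_eq_right hs.1]
  have hd : ∀ t, HasDerivAt
      (fun t => (a + L * ∫ s in (0:ℝ)..t, k s) * Real.exp (-(L * t)))
      (L * k t * Real.exp (-(L * t)) +
        (a + L * ∫ s in (0:ℝ)..t, k s) * (Real.exp (-(L * t)) * -(L * 1))) t := fun t =>
    (((hkc.integral_hasStrictDerivAt 0 t).hasDerivAt.const_mul L).const_add a).mul
      ((((hasDerivAt_id t).const_mul L).neg).exp)
  have hanti : AntitoneOn
      (fun t => (a + L * ∫ s in (0:ℝ)..t, k s) * Real.exp (-(L * t))) (Icc 0 T) := by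
    refine antitoneOn_of_deriv_nonpos (convex_Icc 0 T)
      (fun t _ => (hd t).continuousAt.continuousWithinAt)
      (fun t _ => (hd t).differentiableAt.differentiableWithinAt) fun t ht => ?_
    rw [interior_Icc] at ht
    rw [(hd t).deriv]
    have h1 := h t ⟨ht.1.le, ht.2.le⟩
    rw [← hkg t ht.1.le] at h1
    have h2 : k t = g t := by simp [hk, max_eq_right ht.1.le]
    rw [← h2] at h1
    have h3 := mul_nonneg (mul_nonneg hL (Real.exp_pos (-(L * t))).le) (sub_nonneg.2 h1)
    linarith
  have h0 := hanti ⟨le_rfl, hT⟩ ⟨hT, le_rfl⟩ hT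
  simp only [intervalIntegral.integral_same, mul_zero, add_zero, neg_zero, Real.exp_zero,
    mul_one] at h0
  rw [hkg T hT, Real.exp_neg, ← div_eq_mul_inv, div_le_iff₀ (Real.exp_pos _)] at h0
  exact (h T ⟨hT, le_rfl⟩).trans h0

section OperatorFamily

variable {E F : Type*} [NormedAddCommGroup E] [NormedSpace ℝ E]
  [NormedAddCommGroup F] [NormedSpace ℝ F]

/-- A uniformly bounded, strongly continuous family of operators applied to a continuous curve
gives a continuous curve. -/
theorem ContinuousOn.apply_of_strongly_continuous {X : Type*} [TopologicalSpace X]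
    {A : X → E →L[ℝ] F} {w : X → E} {D : Set X} {C : ℝ} (hA : ∀ x ∈ D, ‖A x‖ ≤ C)
    (hAc : ∀ v, ContinuousOn (fun x => A x v) D) (hw : ContinuousOn w D) :
    ContinuousOn (fun x => A x (w x)) D := by
  intro x hx
  have h1 : Filter.Tendsto (fun y => A y (w y - w x)) (nhdsWithin x D) (nhds 0) := by
    have h2 : Filter.Tendsto (fun y => C * ‖w y - w x‖) (nhdsWithin x D) (nhds 0) := by
      simpa using (((hw x hx).sub_const (w x)).norm.const_mul C)
    refine squeeze_zero_norm' ?_ h2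
    filter_upwards [self_mem_nhdsWithin] with y hy
    exact (A y).le_of_opNorm_le (hA y hy) _
  simpa [ContinuousWithinAt] using h1.add (hAc (w x) x hx)

/-- The operator norm of a strongly continuous family is lower semicontinuous. -/
theorem lowerSemicontinuous_norm_of_strongly_continuous {X : Type*} [TopologicalSpace X]
    {A : X → E →L[ℝ] F} (hA : ∀ v, Continuous fun x => A x v) :
    LowerSemicontinuous fun x => ‖A x‖ := by
  intro x c hc
  obtain ⟨v, hv, hcv⟩ := (A x).exists_lt_apply_of_lt_opNorm hc
  filter_upwards [(hA v).norm.continuousAt.eventually_const_lt hcv] with y hy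
  exact hy.trans_le ((A y).unit_le_opNorm v hv.le)

theorem intervalIntegrable_norm_of_strongly_continuous {A : ℝ → E →L[ℝ] F} {C t : ℝ}
    (hA : ∀ s ≥ (0:ℝ), ‖A s‖ ≤ C) (hAc : ∀ v, ContinuousOn (fun s => A s v) (Ici 0))
    (ht : 0 ≤ t) : IntervalIntegrable (fun s => ‖A s‖) volume 0 t := by
  have hm : Measurable fun s : ℝ => ‖A (max 0 s)‖ :=
    (lowerSemicontinuous_norm_of_strongly_continuous fun v =>
      (hAc v).comp_continuous (by fun_prop) fun s => le_max_left 0 s).measurable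
  have hi : IntervalIntegrable (fun s : ℝ => ‖A (max 0 s)‖) volume 0 t :=
    (intervalIntegrable_const (c := C)).mono_fun hm.aestronglyMeasurable <|
      Filter.Eventually.of_forall fun s => by
        simpa using (hA _ (le_max_left 0 s)).trans (le_abs_self C)
  refine hi.congr fun s hs => ?_
  rw [uIoc_of_le ht] at hs
  simp [max_eq_right hs.1.le]

theorem intervalIntegrable_convolution_of_strongly_continuous {A : ℝ → E →L[ℝ] F}
    {w : ℝ → E} {C t : ℝ} (hA : ∀ s ≥ (0:ℝ), ‖A s‖ ≤ C)
    (hAc : ∀ v, ContinuousOn (fun s => A s v) (Ici 0)) (hw : ContinuousOn w (Ici 0))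
    (ht : 0 ≤ t) : IntervalIntegrable (fun s => A (t - s) (w s)) volume 0 t := by
  refine ContinuousOn.intervalIntegrable ?_
  rw [uIcc_of_le ht]
  exact ContinuousOn.apply_of_strongly_continuous (fun s hs => hA _ (sub_nonneg.2 hs.2))
    (fun v => (hAc v).comp (by fun_prop) fun s hs => sub_nonneg.2 hs.2)
    (hw.mono fun s hs => hs.1)

/-- Convolution with a contractive, strongly continuous family is a contraction into `L¹`. -/
theorem norm_integral_convolution_le {A : ℝ → E →L[ℝ] F} {w : ℝ → E} {g : ℝ → ℝ} {t : ℝ}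
    (hA : ∀ s ≥ (0:ℝ), ‖A s‖ ≤ 1) (hw : ∀ s ∈ Icc 0 t, ‖w s‖ ≤ g s)
    (hg : ContinuousOn g (Ici 0)) (ht : 0 ≤ t) :
    ‖∫ s in (0:ℝ)..t, A (t - s) (w s)‖ ≤ ∫ s in (0:ℝ)..t, g s := by
  refine intervalIntegral.norm_integral_le_of_norm_le ht
    (Filter.Eventually.of_forall fun s hs => ?_) ?_
  · have h1 := (A (t - s)).le_of_opNorm_le (hA _ (sub_nonneg.2 hs.2)) (w s)
    rw [one_mul] at h1
    exact h1.trans (hw s ⟨hs.1.le, hs.2⟩)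
  · refine ContinuousOn.intervalIntegrable (hg.mono ?_)
    rw [uIcc_of_le ht]
    exact fun s hs => hs.1

end OperatorFamily

/-- continuous dependence of solutions on the resolvent family
(i.e. on the nonlocal kernel): if `∫₀ᵗ ‖S τ - S̄ τ‖ dτ ≤ ε e^{η t}`, then
`‖u t - ū t‖ ≤ (sup_{s∈[0,t]} ‖φ s - φ̄ s‖ + L M̄ ε e^{(L+η)t}) e^{L t}`. -/
theorem volterra_kernel_dependence
    {E : Type*} [NormedAddCommGroup E] [NormedSpace ℝ E] [CompleteSpace E]
    (S S' : ℝ → E →L[ℝ] E)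
    (hS_norm : ∀ t ≥ (0:ℝ), ‖S t‖ ≤ 1)
    (hS'_norm : ∀ t ≥ (0:ℝ), ‖S' t‖ ≤ 1)
    (hS_cont : ∀ v : E, ContinuousOn (fun t => S t v) (Set.Ici (0:ℝ)))
    (hS'_cont : ∀ v : E, ContinuousOn (fun t => S' t v) (Set.Ici (0:ℝ)))
    (L : ℝ) (hL : 0 < L)
    (f : E → E) (hf0 : f 0 = 0)
    (hf_lip : ∀ u v : E, ‖f u - f v‖ ≤ L * ‖u - v‖)
    (ε η : ℝ) (hε : 0 < ε) (hη : 0 < η)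
    (hSS' : ∀ t ≥ (0:ℝ), (∫ τ in (0:ℝ)..t, ‖S τ - S' τ‖) ≤ ε * Real.exp (η * t))
    (φ ψ : ℝ → E)
    (hφ_cont : ContinuousOn φ (Set.Ici (0:ℝ)))
    (hφ_bdd : ∃ M : ℝ, ∀ t ≥ (0:ℝ), ‖φ t‖ ≤ M)
    (hψ_cont : ContinuousOn ψ (Set.Ici (0:ℝ)))
    (M' : ℝ) (hM' : IsLUB {x : ℝ | ∃ t ≥ (0:ℝ), ‖ψ t‖ = x} M')
    (u v : ℝ → E)
    (hu_cont : ContinuousOn u (Set.Ici (0:ℝ)))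
    (hv_cont : ContinuousOn v (Set.Ici (0:ℝ)))
    (hu_eqn : ∀ t ≥ (0:ℝ), u t = φ t + ∫ s in (0:ℝ)..t, S (t - s) (f (u s)))
    (hv_eqn : ∀ t ≥ (0:ℝ), v t = ψ t + ∫ s in (0:ℝ)..t, S' (t - s) (f (v s))) :
    ∀ t ≥ (0:ℝ),
      ‖u t - v t‖ ≤
        (sSup ((fun s => ‖φ s - ψ s‖) '' Set.Icc 0 t)
          + L * M' * ε * Real.exp ((L + η) * t)) * Real.exp (L * t) := by
  have hf : Continuous f :=
    (LipschitzWith.of_dist_le_mul (K := L.toNNReal) fun x y => by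
      simpa only [dist_eq_norm, Real.coe_toNNReal L hL.le] using hf_lip x y).continuous
  have hf_norm : ∀ x, ‖f x‖ ≤ L * ‖x‖ := fun x => by simpa [hf0] using hf_lip x 0
  have hψ : ∀ t ≥ (0:ℝ), ‖ψ t‖ ≤ M' := fun t ht => hM'.1 ⟨t, ht, rfl⟩
  have hM'_nonneg : 0 ≤ M' := (norm_nonneg _).trans (hψ 0 le_rfl)
  have hv_norm : ∀ t ≥ (0:ℝ), ‖v t‖ ≤ M' * Real.exp (L * t) := fun t ht => by
    refine le_mul_exp_of_le_add_mul_integral (g := fun s => ‖v s‖) hv_cont.norm hL.le ht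
      fun r hr => ?_
    rw [hv_eqn r hr.1, ← intervalIntegral.integral_const_mul]
    exact (norm_add_le _ _).trans (add_le_add (hψ r hr.1)
      (norm_integral_convolution_le hS'_norm (fun s _ => hf_norm (v s))
        (hv_cont.norm.const_mul L) hr.1))
  have hfu := hf.comp_continuousOn hu_cont
  have hfv := hf.comp_continuousOn hv_cont
  have hD_norm : ∀ t ≥ (0:ℝ), ‖S t - S' t‖ ≤ 2 := fun t ht =>
    (norm_sub_le _ _).trans (by linarith [hS_norm t ht, hS'_norm t ht])
  have hD_cont : ∀ x : E, ContinuousOn (fun t => (S t - S' t) x) (Ici 0) := fun x =>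
    (hS_cont x).sub (hS'_cont x)
  have h_perturb : ∀ t ≥ (0:ℝ), ‖∫ s in (0:ℝ)..t, (S (t - s) - S' (t - s)) (f (v s))‖ ≤
      L * M' * ε * Real.exp ((L + η) * t) := fun t ht => by
    have hint := intervalIntegrable_norm_of_strongly_continuous hD_norm hD_cont ht
    have hint' : IntervalIntegrable (fun s => ‖S (t - s) - S' (t - s)‖) volume 0 t := by
      simpa using (hint.comp_sub_left t).symm
    have hsub : ∫ s in (0:ℝ)..t, ‖S (t - s) - S' (t - s)‖ = ∫ s in (0:ℝ)..t, ‖S s - S' s‖ := by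
      simpa using intervalIntegral.integral_comp_sub_left (a := 0) (b := t)
        (fun s => ‖S s - S' s‖) t
    calc ‖∫ s in (0:ℝ)..t, (S (t - s) - S' (t - s)) (f (v s))‖
        ≤ ∫ s in (0:ℝ)..t, ‖S (t - s) - S' (t - s)‖ * (L * (M' * Real.exp (L * t))) := by
          refine intervalIntegral.norm_integral_le_of_norm_le ht
            (Filter.Eventually.of_forall fun s hs => ?_) (hint'.mul_const _)
          refine (S (t - s) - S' (t - s)).le_opNorm_of_le ((hf_norm _).trans ?_)
          have h1 := hv_norm s hs.1.le
          have h2 := hs.2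
          gcongr
          exact h1.trans (by gcongr)
      _ = (∫ s in (0:ℝ)..t, ‖S s - S' s‖) * (L * (M' * Real.exp (L * t))) := by
          rw [intervalIntegral.integral_mul_const, hsub]
      _ ≤ ε * Real.exp (η * t) * (L * (M' * Real.exp (L * t))) := by
          gcongr
          exact hSS' t ht
      _ = L * M' * ε * Real.exp ((L + η) * t) := by
          rw [add_mul, Real.exp_add]
          ring
  intro T hT
  refine le_mul_exp_of_le_add_mul_integral (g := fun s => ‖u s - v s‖)
    (hu_cont.sub hv_cont).norm hL.le hT fun t ht => ?_
  have h_sup : ‖φ t - ψ t‖ ≤ sSup ((fun s => ‖φ s - ψ s‖) '' Icc 0 T) :=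
    le_csSup (isCompact_Icc.bddAbove_image
      ((hφ_cont.sub hψ_cont).norm.mono fun s hs => hs.1)) (mem_image_of_mem _ ht)
  have h_split : u t - v t = (φ t - ψ t)
      + (∫ s in (0:ℝ)..t, (S (t - s) - S' (t - s)) (f (v s)))
      + ∫ s in (0:ℝ)..t, S (t - s) (f (u s) - f (v s)) := by
    have iu := intervalIntegrable_convolution_of_strongly_continuous hS_norm hS_cont hfu ht.1
    have iv := intervalIntegrable_convolution_of_strongly_continuous hS_norm hS_cont hfv ht.1
    have iv' := intervalIntegrable_convolution_of_strongly_continuous hS'_norm hS'_cont hfv ht.1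
    simp only [Function.comp_apply] at iu iv iv'
    simp only [map_sub, sub_apply]
    rw [intervalIntegral.integral_sub iv iv', intervalIntegral.integral_sub iu iv,
      hu_eqn t ht.1, hv_eqn t ht.1]
    abel
  change ‖u t - v t‖ ≤ _
  rw [h_split, ← intervalIntegral.integral_const_mul]
  refine norm_add₃_le.trans (add_le_add (add_le_add h_sup ((h_perturb t ht.1).trans ?_))
    (norm_integral_convolution_le hS_norm (fun s _ => hf_lip (u s) (v s))
      ((hu_cont.sub hv_cont).norm.const_mul L) ht.1))
  have := ht.2
  gcongr
end

section
/- For each bounded continuous φ : [0,∞) → E let u_φ denote the unique continuous solution of u_φ(t) = φ(t) + ∫₀ᵗ S(t−s) f(u_φ(s)) ds, and define (T_t φ)(θ) := φ(t+θ) + ∫₀ᵗ S(t+θ−τ) f(u_φ(τ)) dτ for t, θ ≥ 0. Then T_t φ is again bounded and continuous, T_0 φ = φ, and the semigroup property T_{t+s} φ = T_t (T_s φ) holds for all t, s ≥ 0. -/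
open MeasureTheory Set

section Convolution

variable {E : Type*} [NormedAddCommGroup E] [NormedSpace ℝ E]

/-- A strongly continuous family of contractions on `[0, ∞)` acts jointly continuously. -/
lemma continuous_contraction_max_apply {S : ℝ → E →L[ℝ] E}
    (hS_norm : ∀ t ≥ (0 : ℝ), ‖S t‖ ≤ 1)
    (hS_cont : ∀ v : E, ContinuousOn (fun t => S t v) (Ici (0 : ℝ))) :
    Continuous fun p : ℝ × E => S (max p.1 0) p.2 := by
  refine continuous_prod_of_continuous_lipschitzWith' _ 1 (fun r => ?_) fun v => ?_
  · refine LipschitzWith.of_dist_le_mul fun u v => ?_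
    rw [dist_eq_norm, dist_eq_norm, ← map_sub]
    exact (S (max r 0)).le_of_opNorm_le (hS_norm _ (le_max_right _ _)) _
  · exact (hS_cont v).comp_continuous (by fun_prop) fun r => mem_Ici.2 (le_max_right _ _)

lemma ContinuousOn.continuous_comp_max_zero {X : Type*} [TopologicalSpace X] {g : ℝ → X}
    (hg : ContinuousOn g (Ici (0 : ℝ))) : Continuous fun τ => g (max τ 0) :=
  hg.comp_continuous (by fun_prop) fun _ => mem_Ici.2 (le_max_right _ _)

lemma continuousOn_contraction_convolution {S : ℝ → E →L[ℝ] E}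
    (hS_norm : ∀ t ≥ (0 : ℝ), ‖S t‖ ≤ 1)
    (hS_cont : ∀ v : E, ContinuousOn (fun t => S t v) (Ici (0 : ℝ)))
    {g : ℝ → E} (hg : ContinuousOn g (Ici (0 : ℝ))) (c : ℝ) :
    ContinuousOn (fun τ => S (c - τ) (g τ)) (Icc 0 c) := by
  have h := (continuous_contraction_max_apply hS_norm hS_cont).comp
    ((by fun_prop : Continuous fun τ => c - τ).prodMk hg.continuous_comp_max_zero)
  refine h.continuousOn.congr fun τ hτ => ?_
  simp [max_eq_left hτ.1, max_eq_left (sub_nonneg.2 hτ.2)]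

lemma continuousOn_shifted_contraction_convolution {S : ℝ → E →L[ℝ] E}
    (hS_norm : ∀ t ≥ (0 : ℝ), ‖S t‖ ≤ 1)
    (hS_cont : ∀ v : E, ContinuousOn (fun t => S t v) (Ici (0 : ℝ)))
    {g : ℝ → E} (hg : ContinuousOn g (Ici (0 : ℝ))) {t : ℝ} (ht : 0 ≤ t) :
    ContinuousOn (fun θ => ∫ τ in (0 : ℝ)..t, S (t + θ - τ) (g τ)) (Ici (0 : ℝ)) := by
  have h : Continuous (Function.uncurry fun θ τ : ℝ => S (max (t + θ - τ) 0) (g (max τ 0))) :=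
    (continuous_contraction_max_apply hS_norm hS_cont).comp
      ((by fun_prop : Continuous fun p : ℝ × ℝ => t + p.1 - p.2).prodMk
        (hg.continuous_comp_max_zero.comp continuous_snd))
  refine (intervalIntegral.continuous_parametric_intervalIntegral_of_continuous' (μ := volume)
    h 0 t).continuousOn.congr fun θ hθ => ?_
  refine intervalIntegral.integral_congr fun τ hτ => ?_
  rw [uIcc_of_le ht] at hτ
  have hθ' : (0 : ℝ) ≤ θ := hθ
  have h1 : 0 ≤ t + θ - τ := by linarith [hτ.2]
  simp [max_eq_left hτ.1, max_eq_left h1]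

lemma exists_bound_shifted_contraction_convolution {S : ℝ → E →L[ℝ] E}
    (hS_norm : ∀ t ≥ (0 : ℝ), ‖S t‖ ≤ 1)
    {g : ℝ → E} (hg : ContinuousOn g (Ici (0 : ℝ))) {t : ℝ} (ht : 0 ≤ t) :
    ∃ M : ℝ, ∀ θ ≥ (0 : ℝ), ‖∫ τ in (0 : ℝ)..t, S (t + θ - τ) (g τ)‖ ≤ M := by
  obtain ⟨C, hC⟩ := isCompact_Icc.exists_bound_of_continuousOn
    (hg.mono (Icc_subset_Ici_self : Icc 0 t ⊆ Ici 0))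
  refine ⟨C * |t - 0|, fun θ hθ => intervalIntegral.norm_integral_le_of_norm_le_const ?_⟩
  intro τ hτ
  rw [uIoc_of_le ht] at hτ
  have h1 : 0 ≤ t + θ - τ := by linarith [hτ.2]
  calc ‖S (t + θ - τ) (g τ)‖ ≤ 1 * ‖g τ‖ := (S _).le_of_opNorm_le (hS_norm _ h1) _
    _ ≤ C := by rw [one_mul]; exact hC τ ⟨hτ.1.le, hτ.2⟩

lemma contraction_convolution_add {S : ℝ → E →L[ℝ] E}
    (hS_norm : ∀ t ≥ (0 : ℝ), ‖S t‖ ≤ 1)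
    (hS_cont : ∀ v : E, ContinuousOn (fun t => S t v) (Ici (0 : ℝ)))
    {g : ℝ → E} (hg : ContinuousOn g (Ici (0 : ℝ))) {a b c : ℝ}
    (ha : 0 ≤ a) (hb : 0 ≤ b) (hc : a + b ≤ c) :
    ∫ τ in (0 : ℝ)..(a + b), S (c - τ) (g τ) =
      (∫ τ in (0 : ℝ)..a, S (c - τ) (g τ)) +
        ∫ τ in (0 : ℝ)..b, S (c - a - τ) (g (a + τ)) := by
  have hcont := continuousOn_contraction_convolution hS_norm hS_cont hg c
  have h1 : IntervalIntegrable (fun τ => S (c - τ) (g τ)) volume 0 a :=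
    (hcont.mono (Icc_subset_Icc le_rfl (by linarith))).intervalIntegrable_of_Icc ha
  have h2 : IntervalIntegrable (fun τ => S (c - τ) (g τ)) volume a (a + b) :=
    (hcont.mono (Icc_subset_Icc ha hc)).intervalIntegrable_of_Icc (by linarith)
  rw [← intervalIntegral.integral_add_adjacent_intervals h1 h2]
  have h3 := intervalIntegral.integral_comp_add_left (a := 0) (b := b)
    (fun τ => S (c - τ) (g τ)) a
  simp only [add_zero, ← sub_sub] at h3
  rw [h3]

end Convolution

/-- the operators `(T_t φ)(θ) = φ(t+θ) + ∫₀ᵗ S(t+θ-τ) f(u_φ(τ)) dτ`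
map bounded continuous functions to bounded continuous functions, satisfy
`T_0 φ = φ` and the semigroup property `T_{t+s} φ = T_t (T_s φ)`. -/
theorem volterra_semigroup
    {E : Type*} [NormedAddCommGroup E] [NormedSpace ℝ E] [CompleteSpace E]
    (S : ℝ → E →L[ℝ] E)
    (hS_norm : ∀ t ≥ (0:ℝ), ‖S t‖ ≤ 1)
    (hS_cont : ∀ v : E, ContinuousOn (fun t => S t v) (Set.Ici (0:ℝ)))
    (L : ℝ) (hL : 0 < L)
    (f : E → E) (hf0 : f 0 = 0)
    (hf_lip : ∀ u v : E, ‖f u - f v‖ ≤ L * ‖u - v‖)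
    (sol : (ℝ → E) → ℝ → E)
    (hsol : ∀ φ : ℝ → E, ContinuousOn φ (Set.Ici (0:ℝ)) →
      (∃ M : ℝ, ∀ t ≥ (0:ℝ), ‖φ t‖ ≤ M) →
      ContinuousOn (sol φ) (Set.Ici (0:ℝ)) ∧
        ∀ t ≥ (0:ℝ), sol φ t = φ t + ∫ s in (0:ℝ)..t, S (t - s) (f (sol φ s)))
    (hsol_uniq : ∀ φ : ℝ → E, ContinuousOn φ (Set.Ici (0:ℝ)) →
      (∃ M : ℝ, ∀ t ≥ (0:ℝ), ‖φ t‖ ≤ M) →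
      ∀ v : ℝ → E, ContinuousOn v (Set.Ici (0:ℝ)) →
        (∀ t ≥ (0:ℝ), v t = φ t + ∫ s in (0:ℝ)..t, S (t - s) (f (v s))) →
        ∀ t ≥ (0:ℝ), v t = sol φ t)
    (T : ℝ → (ℝ → E) → ℝ → E)
    (hT : ∀ (t : ℝ) (φ : ℝ → E) (θ : ℝ),
      T t φ θ = φ (t + θ) + ∫ τ in (0:ℝ)..t, S (t + θ - τ) (f (sol φ τ))) :
    ∀ φ : ℝ → E, ContinuousOn φ (Set.Ici (0:ℝ)) →
      (∃ M : ℝ, ∀ t ≥ (0:ℝ), ‖φ t‖ ≤ M) →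
      (∀ t ≥ (0:ℝ), ContinuousOn (T t φ) (Set.Ici (0:ℝ)) ∧
        ∃ M : ℝ, ∀ θ ≥ (0:ℝ), ‖T t φ θ‖ ≤ M) ∧
      (∀ θ ≥ (0:ℝ), T 0 φ θ = φ θ) ∧
      (∀ t ≥ (0:ℝ), ∀ s ≥ (0:ℝ), ∀ θ ≥ (0:ℝ), T (t + s) φ θ = T t (T s φ) θ) := by
  intro φ hφ hφb
  have hf : Continuous f := (LipschitzWith.of_dist_le_mul (K := ⟨L, hL.le⟩) fun u v => by
    rw [dist_eq_norm, dist_eq_norm]; exact hf_lip u v).continuous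
  obtain ⟨hu, hueq⟩ := hsol φ hφ hφb
  have hg : ContinuousOn (fun τ => f (sol φ τ)) (Ici (0 : ℝ)) := hf.comp_continuousOn hu
  have hTc : ∀ t ≥ (0 : ℝ), ContinuousOn (T t φ) (Ici (0 : ℝ)) := by
    intro t ht
    refine ContinuousOn.congr (ContinuousOn.add (hφ.comp (f := fun θ => t + θ) (by fun_prop)
      fun θ hθ => add_nonneg ht hθ)
      (continuousOn_shifted_contraction_convolution hS_norm hS_cont hg ht)) fun θ _ => hT t φ θ
  have hTb : ∀ t ≥ (0 : ℝ), ∃ M : ℝ, ∀ θ ≥ (0 : ℝ), ‖T t φ θ‖ ≤ M := by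
    intro t ht
    obtain ⟨M, hM⟩ := hφb
    obtain ⟨N, hN⟩ := exists_bound_shifted_contraction_convolution hS_norm hg ht
    refine ⟨M + N, fun θ hθ => ?_⟩
    rw [hT]
    exact norm_add_le_of_le (hM _ (add_nonneg ht hθ)) (hN θ hθ)
  refine ⟨fun t ht => ⟨hTc t ht, hTb t ht⟩, fun θ _ => by simp [hT], fun t ht s hs θ hθ => ?_⟩
  have hshift : ∀ r ≥ (0 : ℝ), sol φ (s + r) = sol (T s φ) r := by
    refine hsol_uniq (T s φ) (hTc s hs) (hTb s hs) (fun r => sol φ (s + r))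
      (hu.comp (by fun_prop) fun r hr => add_nonneg hs hr) fun r hr => ?_
    rw [hueq (s + r) (add_nonneg hs hr), hT,
      contraction_convolution_add hS_norm hS_cont hg hs hr le_rfl, add_sub_cancel_left, add_assoc]
  have hint : ∫ τ in (0 : ℝ)..t, S (t + θ - τ) (f (sol (T s φ) τ)) =
      ∫ τ in (0 : ℝ)..t, S (t + θ - τ) (f (sol φ (s + τ))) := by
    refine intervalIntegral.integral_congr fun τ hτ => ?_
    rw [uIcc_of_le ht] at hτ
    simp only [hshift τ hτ.1]
  have hsplit := contraction_convolution_add hS_norm hS_cont hg hs ht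
    (le_add_of_nonneg_right hθ)
  rw [show s + t + θ - s = t + θ by ring] at hsplit
  rw [hT (t + s), hT t, hT s, hint, add_comm t s, hsplit, ← add_assoc s t θ, ← add_assoc]
end

section
/- Let α ∈ (0,1), C₁ > 0, and suppose ‖S(σ)‖ ≤ 1 for all σ ≥ 0 and ‖S(t+θ) − S(t)‖ ≤ C₁ θ^α t^{−α} for all t > 0, θ > 0. Let u₀ ∈ E with ‖u₀‖ ≤ R and let u : [0,∞) → E be a continuous function satisfying u(t) = S(t)u₀ + ∫₀ᵗ S(t−s) f(u(s)) ds for all t ≥ 0, with ∫₀^∞ ‖f(u(s))‖ ds ≤ K and sup_{s≥0} ‖f(u(s))‖ ≤ B. Then for every T > 0, every t ≥ T, and every θ ∈ (0,1], ‖u(t+θ) − u(t)‖ ≤ ( C₁ T^{−α} (R + K) + C₁ B T^{1−α}/(1−α) + B ) θ^α. -/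
open MeasureTheory Set

/-- If `φ` vanishes at `b` and stays `M`-close to `φ a` wherever it is nonzero on `[a, b]`,
then `φ a` itself has norm at most `M`. -/
lemma norm_left_le_of_zero_right {E : Type*} [NormedAddCommGroup E] {φ : ℝ → E} {a b M : ℝ}
    (hab : a ≤ b) (hφ : ContinuousOn φ (Set.Icc a b)) (ha : φ a ≠ 0) (hb : φ b = 0)
    (h : ∀ y ∈ Set.Icc a b, φ y ≠ 0 → ‖φ y - φ a‖ ≤ M) : ‖φ a‖ ≤ M := by
  have hZ : IsCompact (Set.Icc a b ∩ φ ⁻¹' {0}) :=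
    isCompact_Icc.of_isClosed_subset
      (hφ.preimage_isClosed_of_isClosed isClosed_Icc isClosed_singleton) Set.inter_subset_left
  obtain ⟨c, ⟨hc, hc0⟩, hmin⟩ := hZ.exists_isLeast ⟨b, ⟨hab, le_rfl⟩, hb⟩
  have hc0 : φ c = 0 := hc0
  have hac : a < c := lt_of_le_of_ne hc.1 (by rintro rfl; exact ha hc0)
  have hsub : Set.Ico a c ⊆ Set.Icc a b := fun y hy => ⟨hy.1, hy.2.le.trans hc.2⟩
  have hcl : c ∈ closure (Set.Ico a c) := by
    rw [closure_Ico hac.ne]; exact ⟨hac.le, le_rfl⟩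
  have hcont : ContinuousWithinAt (fun y => ‖φ y - φ a‖) (Set.Ico a c) c :=
    (((hφ c hc).mono hsub).sub continuousWithinAt_const).norm
  have := hcont.closure_le hcl continuousWithinAt_const (g := fun _ => M) fun y hy =>
    h y (hsub hy) fun h0 => (hmin ⟨hsub hy, h0⟩).not_gt hy.2
  simpa [hc0] using this

/-- To bound the oscillation of a continuous function it suffices to compare points at which
it does not vanish. -/
lemma norm_sub_le_of_forall_ne_zero {E : Type*} [NormedAddCommGroup E] {φ : ℝ → E} {a b M : ℝ}
    (hab : a ≤ b) (hM : 0 ≤ M) (hφ : ContinuousOn φ (Set.Icc a b))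
    (h : ∀ x ∈ Set.Icc a b, ∀ y ∈ Set.Icc a b, x ≤ y → φ x ≠ 0 → φ y ≠ 0 → ‖φ y - φ x‖ ≤ M) :
    ‖φ b - φ a‖ ≤ M := by
  have hla : a ∈ Set.Icc a b := ⟨le_rfl, hab⟩
  have hrb : b ∈ Set.Icc a b := ⟨hab, le_rfl⟩
  by_cases ha : φ a = 0 <;> by_cases hb : φ b = 0
  · simpa [ha, hb] using hM
  · have hneg : ∀ y ∈ Set.Icc (-b) (-a), -y ∈ Set.Icc a b := fun y hy =>
      ⟨by linarith [hy.2], by linarith [hy.1]⟩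
    have := norm_left_le_of_zero_right (φ := fun y => φ (-y)) (a := -b) (b := -a) (M := M)
      (by linarith) (hφ.comp continuousOn_neg hneg) (by simpa using hb) (by simpa using ha)
      fun y hy h0 => by
        simpa [norm_sub_rev] using h (-y) (hneg y hy) b hrb (by linarith [hy.1]) h0 hb
    simpa [ha] using this
  · simpa [hb] using
      norm_left_le_of_zero_right hab hφ ha hb fun y hy h0 => h a hla y hy hy.1 ha h0
  · exact h a hla b hrb hab ha hb

/-- A one-sided operator Hölder estimate yields norm continuity on `(0, ∞)`. -/
lemma continuousOn_Ioi_of_holder {F : Type*} [NormedAddCommGroup F] {S : ℝ → F} {α C : ℝ}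
    (hα : 0 < α) (hC : 0 ≤ C)
    (h : ∀ t > (0 : ℝ), ∀ θ > (0 : ℝ), ‖S (t + θ) - S t‖ ≤ C * θ ^ α * t ^ (-α)) :
    ContinuousOn S (Set.Ioi 0) := by
  intro t ht
  have ht : 0 < t := ht
  refine ContinuousAt.continuousWithinAt ?_
  have key : ∀ x > t / 2, ∀ y ≥ x, ‖S y - S x‖ ≤ C * |y - x| ^ α * (t / 2) ^ (-α) := by
    intro x hx y hy
    have hx0 : 0 < x := by linarith
    rcases hy.eq_or_lt with rfl | hlt
    · simp [Real.zero_rpow hα.ne']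
    · have := h x hx0 (y - x) (by linarith)
      rw [add_sub_cancel] at this
      rw [abs_of_pos (sub_pos.2 hlt)]
      refine this.trans (mul_le_mul_of_nonneg_left ?_ ?_)
      · exact Real.rpow_le_rpow_of_nonpos (by linarith) hx.le (by linarith)
      · exact mul_nonneg hC (Real.rpow_nonneg (by linarith) _)
  rw [ContinuousAt, tendsto_iff_norm_sub_tendsto_zero]
  have hlim : Filter.Tendsto (fun y : ℝ => C * |y - t| ^ α * (t / 2) ^ (-α)) (nhds t) (nhds 0) := by
    have : ContinuousAt (fun y : ℝ => C * |y - t| ^ α * (t / 2) ^ (-α)) t := by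
      refine ((ContinuousAt.rpow_const (by fun_prop) (Or.inr hα.le)).const_mul C).mul_const _
    simpa [ContinuousAt, Real.zero_rpow hα.ne'] using this
  refine squeeze_zero' (Filter.Eventually.of_forall fun _ => norm_nonneg _) ?_ hlim
  filter_upwards [lt_mem_nhds (half_lt_self ht)] with y hy
  rcases le_total t y with hty | hyt
  · exact key t (half_lt_self ht) y hty
  · rw [norm_sub_rev, abs_sub_comm]
    exact key y hy t hyt

/-- Hölder estimate for the convolution of `S` with `g`, between two times at which the
convolution integrals converge. -/
lemma norm_convolution_sub_le {E : Type*} [NormedAddCommGroup E] [NormedSpace ℝ E]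
    {S : ℝ → E →L[ℝ] E} {α C K B : ℝ} {g : ℝ → E} (hα : α ∈ Set.Ioo (0 : ℝ) 1) (hC : 0 ≤ C)
    (hS_norm : ∀ σ ≥ (0 : ℝ), ‖S σ‖ ≤ 1)
    (hS_holder : ∀ t > (0 : ℝ), ∀ θ > (0 : ℝ), ‖S (t + θ) - S t‖ ≤ C * θ ^ α * t ^ (-α))
    (hg : IntegrableOn (fun s => ‖g s‖) (Set.Ioi (0 : ℝ)))
    (hK : (∫ s in Set.Ioi (0 : ℝ), ‖g s‖) ≤ K) (hB : ∀ s ≥ (0 : ℝ), ‖g s‖ ≤ B)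
    {T t t' : ℝ} (hT : 0 < T) (hTt : T ≤ t) (htt' : t < t') (ht' : t' ≤ t + 1)
    (hint : IntervalIntegrable (fun s => S (t - s) (g s)) volume 0 t)
    (hint' : IntervalIntegrable (fun s => S (t' - s) (g s)) volume 0 t') :
    ‖(∫ s in (0 : ℝ)..t', S (t' - s) (g s)) - ∫ s in (0 : ℝ)..t, S (t - s) (g s)‖ ≤
      (C * T ^ (-α) * K + C * B * T ^ (1 - α) / (1 - α) + B) * (t' - t) ^ α := by
  have hB0 : 0 ≤ B := (norm_nonneg _).trans (hB 0 le_rfl)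
  have hθ : 0 < t' - t := sub_pos.2 htt'
  have ht0 : 0 < t := hT.trans_le hTt
  set D := C * (t' - t) ^ α with hD
  have hD0 : 0 ≤ D := mul_nonneg hC (Real.rpow_nonneg hθ.le _)
  have hi : ∀ {a b c d : ℝ} {F : ℝ → E}, IntervalIntegrable F volume c d → c ≤ a → a ≤ b → b ≤ d →
      IntervalIntegrable F volume a b := fun h h1 h2 h3 =>
    h.mono_set (by
      rw [Set.uIcc_of_le h2, Set.uIcc_of_le (by linarith)]
      exact Set.Icc_subset_Icc h1 h3)
  have hdiff : IntervalIntegrable (fun s => S (t' - s) (g s) - S (t - s) (g s)) volume 0 t :=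
    (hi hint' le_rfl ht0.le htt'.le).sub hint
  have hpt : ∀ s ∈ Set.Ico 0 t,
      ‖S (t' - s) (g s) - S (t - s) (g s)‖ ≤ D * (t - s) ^ (-α) * ‖g s‖ := by
    intro s hs
    have h1 := hS_holder (t - s) (by linarith [hs.2]) (t' - t) hθ
    rw [show t - s + (t' - t) = t' - s by ring] at h1
    rw [← sub_apply]
    exact (ContinuousLinearMap.le_opNorm _ _).trans
      (mul_le_mul_of_nonneg_right h1 (norm_nonneg _))
  have hsplit : (∫ s in (0 : ℝ)..t', S (t' - s) (g s)) - ∫ s in (0 : ℝ)..t, S (t - s) (g s) =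
      (∫ s in (0 : ℝ)..(t - T), (S (t' - s) (g s) - S (t - s) (g s))) +
      (∫ s in (t - T)..t, (S (t' - s) (g s) - S (t - s) (g s))) +
      ∫ s in t..t', S (t' - s) (g s) := by
    rw [intervalIntegral.integral_add_adjacent_intervals
      (hi (a := 0) (b := t - T) hdiff le_rfl (by linarith) (by linarith))
      (hi hdiff (by linarith) (by linarith) le_rfl),
      intervalIntegral.integral_sub (hi hint' le_rfl ht0.le htt'.le) hint,
      ← intervalIntegral.integral_add_adjacent_intervals (hi hint' le_rfl ht0.le htt'.le)
        (hi hint' ht0.le htt'.le le_rfl)]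
    abel
  have hfar : ‖∫ s in (0 : ℝ)..(t - T), (S (t' - s) (g s) - S (t - s) (g s))‖ ≤
      D * T ^ (-α) * K := by
    have hgi : IntervalIntegrable (fun s => ‖g s‖) volume 0 (t - T) :=
      (intervalIntegrable_iff_integrableOn_Ioc_of_le (by linarith)).2
        (hg.mono_set Set.Ioc_subset_Ioi_self)
    have hDT : 0 ≤ D * T ^ (-α) := mul_nonneg hD0 (Real.rpow_nonneg hT.le _)
    refine (intervalIntegral.norm_integral_le_of_norm_le (by linarith)
      (Filter.Eventually.of_forall fun s hs => ?_) (hgi.const_mul (D * T ^ (-α)))).trans ?_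
    · refine (hpt s ⟨hs.1.le, by linarith [hs.2]⟩).trans ?_
      gcongr ?_ * _
      exact mul_le_mul_of_nonneg_left
        (Real.rpow_le_rpow_of_nonpos hT (by linarith [hs.2]) (by linarith [hα.1])) hD0
    · rw [intervalIntegral.integral_const_mul, intervalIntegral.integral_of_le (by linarith)]
      refine mul_le_mul_of_nonneg_left (le_trans ?_ hK) hDT
      exact setIntegral_mono_set hg (Filter.Eventually.of_forall fun _ => norm_nonneg _)
        Set.Ioc_subset_Ioi_self.eventuallyLE
  have hnear : ‖∫ s in (t - T)..t, (S (t' - s) (g s) - S (t - s) (g s))‖ ≤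
      D * B * (T ^ (1 - α) / (1 - α)) := by
    have hri : IntervalIntegrable (fun s => (t - s) ^ (-α)) volume (t - T) t := by
      have := (intervalIntegral.intervalIntegrable_rpow' (a := T) (b := 0)
        (by linarith [hα.2] : -1 < -α)).comp_sub_left t
      simpa using this
    have hval : ∫ s in (t - T)..t, (t - s) ^ (-α) = T ^ (1 - α) / (1 - α) := by
      rw [intervalIntegral.integral_comp_sub_left (fun x : ℝ => x ^ (-α)) t,
        integral_rpow (Or.inl (by linarith [hα.2]))]
      rw [show -α + 1 = 1 - α by ring]
      simp [Real.zero_rpow (by linarith [hα.2] : 1 - α ≠ 0)]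
    refine (intervalIntegral.norm_integral_le_of_norm_le (by linarith) ?_
      (hri.const_mul (D * B))).trans ?_
    · filter_upwards [Measure.ae_ne volume t] with s hst hs
      have hlt := lt_of_le_of_ne hs.2 hst
      refine (hpt s ⟨by linarith [hs.1], hlt⟩).trans ?_
      rw [mul_right_comm]
      refine mul_le_mul_of_nonneg_right (mul_le_mul_of_nonneg_left
        (hB s (by linarith [hs.1])) hD0) (Real.rpow_nonneg (by linarith) _)
    · rw [intervalIntegral.integral_const_mul, hval]
  have hlast : ‖∫ s in t..t', S (t' - s) (g s)‖ ≤ B * (t' - t) ^ α := by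
    have := intervalIntegral.norm_integral_le_of_norm_le_const (a := t) (b := t') (C := B)
      (f := fun s => S (t' - s) (g s)) fun s hs => by
        rw [Set.uIoc_of_le htt'.le] at hs
        refine ((S (t' - s)).le_of_opNorm_le (hS_norm _ (by linarith [hs.2])) _).trans ?_
        simpa using hB s (by linarith [hs.1])
    rw [abs_of_pos hθ] at this
    refine this.trans (mul_le_mul_of_nonneg_left ?_ hB0)
    simpa using Real.rpow_le_rpow_of_exponent_ge hθ (by linarith) hα.2.le
  rw [hsplit]
  refine (norm_add₃_le.trans (add_le_add (add_le_add hfar hnear) hlast)).trans_eq ?_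
  rw [hD]; ring

/-- time-Hölder continuity of mild solutions, deduced from the
operator Hölder estimate `‖S(t+θ) - S(t)‖ ≤ C₁ θ^α t^{-α}`. -/
theorem mild_solution_time_holder
    {E : Type*} [NormedAddCommGroup E] [NormedSpace ℝ E] [CompleteSpace E]
    (S : ℝ → E →L[ℝ] E) (α C₁ : ℝ)
    (hα : α ∈ Set.Ioo (0:ℝ) 1) (hC₁ : 0 < C₁)
    (hS_norm : ∀ σ ≥ (0:ℝ), ‖S σ‖ ≤ 1)
    (hS_holder : ∀ t > (0:ℝ), ∀ θ > (0:ℝ), ‖S (t + θ) - S t‖ ≤ C₁ * θ ^ α * t ^ (-α))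
    (f : E → E) (R K B : ℝ) (u₀ : E) (hu₀ : ‖u₀‖ ≤ R)
    (u : ℝ → E) (hu_cont : ContinuousOn u (Set.Ici (0:ℝ)))
    (heqn : ∀ t ≥ (0:ℝ), u t = S t u₀ + ∫ s in (0:ℝ)..t, S (t - s) (f (u s)))
    (hK_int : IntegrableOn (fun s => ‖f (u s)‖) (Set.Ioi (0:ℝ)))
    (hK : (∫ s in Set.Ioi (0:ℝ), ‖f (u s)‖) ≤ K)
    (hB : ∀ s ≥ (0:ℝ), ‖f (u s)‖ ≤ B) :
    ∀ T > (0:ℝ), ∀ t ≥ T, ∀ θ ∈ Set.Ioc (0:ℝ) 1,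
      ‖u (t + θ) - u t‖ ≤
        (C₁ * T ^ (-α) * (R + K) + C₁ * B * T ^ (1 - α) / (1 - α) + B) * θ ^ α := by
  intro T hT t ht θ hθ
  have ht0 : 0 < t := hT.trans_le ht
  have hα1 : 0 < 1 - α := by linarith [hα.2]
  have hB0 : 0 ≤ B := (norm_nonneg _).trans (hB 0 le_rfl)
  have hK0 : 0 ≤ K := (integral_nonneg fun _ => norm_nonneg _).trans hK
  have hTα : 0 ≤ T ^ (-α) := Real.rpow_nonneg hT.le _
  have hTα' : 0 ≤ T ^ (1 - α) := Real.rpow_nonneg hT.le _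
  set M := C₁ * T ^ (-α) * K + C₁ * B * T ^ (1 - α) / (1 - α) + B with hM
  have hM0 : 0 ≤ M := by positivity
  set I : ℝ → E := fun r => u r - S r u₀ with hI
  have hI_eq : ∀ r ≥ 0, I r = ∫ s in (0 : ℝ)..r, S (r - s) (f (u s)) := fun r hr => by
    simp only [hI]
    rw [heqn r hr, add_sub_cancel_left]
  have hI_cont : ContinuousOn I (Set.Ioi 0) :=
    (hu_cont.mono Set.Ioi_subset_Ici_self).sub
      ((continuousOn_Ioi_of_holder hα.1 hC₁.le hS_holder).clm_apply continuousOn_const)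
  -- `f ∘ u` need not be measurable, but the integral defining `I r` converges if `I r ≠ 0`.
  have hI_int : ∀ r ≥ 0, I r ≠ 0 →
      IntervalIntegrable (fun s => S (r - s) (f (u s))) volume 0 r := fun r hr h0 => by
    by_contra hn
    exact h0 ((hI_eq r hr).trans (intervalIntegral.integral_undef hn))
  have hI_holder : ‖I (t + θ) - I t‖ ≤ M * θ ^ α := by
    refine norm_sub_le_of_forall_ne_zero (by linarith [hθ.1])
      (mul_nonneg hM0 (Real.rpow_nonneg hθ.1.le _))
      (hI_cont.mono fun r hr => ht0.trans_le hr.1) fun x hx y hy hxy hx0 hy0 => ?_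
    rcases hxy.eq_or_lt with rfl | hlt
    · simpa using mul_nonneg hM0 (Real.rpow_nonneg hθ.1.le _)
    have hx' : 0 ≤ x := ht0.le.trans hx.1
    have hy' : 0 ≤ y := hx'.trans hxy
    rw [hI_eq x hx', hI_eq y hy']
    refine (norm_convolution_sub_le (g := fun s => f (u s)) hα hC₁.le hS_norm hS_holder hK_int hK
      hB hT (ht.trans hx.1) hlt (by linarith [hx.1, hy.2, hθ.2]) (hI_int x hx' hx0)
      (hI_int y hy' hy0)).trans (mul_le_mul_of_nonneg_left ?_ hM0)
    exact Real.rpow_le_rpow (by linarith) (by linarith [hx.1, hy.2]) hα.1.le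
  have hlin : ‖S (t + θ) u₀ - S t u₀‖ ≤ C₁ * θ ^ α * T ^ (-α) * R := by
    have hCθ : 0 ≤ C₁ * θ ^ α := mul_nonneg hC₁.le (Real.rpow_nonneg hθ.1.le _)
    rw [← sub_apply]
    refine (ContinuousLinearMap.le_opNorm _ _).trans
      (mul_le_mul ((hS_holder t ht0 θ hθ.1).trans (mul_le_mul_of_nonneg_left ?_ hCθ)) hu₀
        (norm_nonneg _) (mul_nonneg hCθ hTα))
    exact Real.rpow_le_rpow_of_nonpos hT ht (by linarith [hα.1])
  calc ‖u (t + θ) - u t‖ = ‖(S (t + θ) u₀ - S t u₀) + (I (t + θ) - I t)‖ := by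
        simp only [hI]; congr 1; abel
    _ ≤ C₁ * θ ^ α * T ^ (-α) * R + M * θ ^ α := (norm_add_le _ _).trans (add_le_add hlin hI_holder)
    _ = _ := by rw [hM]; ring
end

section
/- Let α ∈ (0,1), C₃ > 0, T > 0, t ≥ T, and suppose the operator-valued map σ ↦ S(σ) is differentiable in operator norm on (0,∞) with ‖S'(σ)‖ ≤ C₃/σ for all σ > 0. Let u₀ ∈ E with ‖u₀‖ ≤ R and let u : [0,∞) → E be continuous with ∫₀^∞ ‖f(u(s))‖ ds ≤ K and sup_{s≥0} ‖f(u(s))‖ ≤ B. Define g(θ) := S(t+θ)u₀ + ∫₀ᵗ S(t+θ−s) f(u(s)) ds, and assume g is differentiable on (0,∞) with g'(θ) = S'(t+θ)u₀ + ∫₀ᵗ S'(t+θ−s) f(u(s)) ds. Then for all θ > 0, ‖g'(θ)‖ ≤ C₃ ( (R + K) T^{−α} + B·C_{α,T} ) θ^{α−1}, where C_{α,T} := sup_{θ>0} θ^{1−α} log(1 + T/θ) < ∞. -/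
open MeasureTheory Set

theorem log_one_add_le_rpow_div {x p : ℝ} (hx : 0 ≤ x) (hp : 0 < p) (hp1 : p ≤ 1) :
    Real.log (1 + x) ≤ x ^ p / p := by
  rw [le_div_iff₀ hp]
  have h1 := Real.log_le_sub_one_of_pos (Real.rpow_pos_of_pos (by linarith : 0 < 1 + x) p)
  rw [Real.log_rpow (by linarith)] at h1
  have h2 := Real.rpow_add_le_add_rpow zero_le_one hx hp.le hp1
  rw [Real.one_rpow] at h2
  linarith

theorem bddAbove_rpow_mul_log_one_add_div {α T : ℝ} (hα : α ∈ Ioo (0 : ℝ) 1) (hT : 0 < T) :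
    BddAbove ((fun θ => θ ^ (1 - α) * Real.log (1 + T / θ)) '' Ioi (0 : ℝ)) := by
  refine ⟨T ^ (1 - α) / (1 - α), ?_⟩
  rintro _ ⟨θ, hθ, rfl⟩
  have hθ : 0 < θ := hθ
  have hpos := Real.rpow_pos_of_pos hθ (1 - α)
  have h := log_one_add_le_rpow_div (div_pos hT hθ).le (sub_pos.2 hα.2) (by linarith [hα.1])
  rw [Real.div_rpow hT.le hθ.le] at h
  calc θ ^ (1 - α) * Real.log (1 + T / θ)
      ≤ θ ^ (1 - α) * (T ^ (1 - α) / θ ^ (1 - α) / (1 - α)) := by gcongr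
    _ = T ^ (1 - α) / (1 - α) := by field_simp

theorem one_div_add_le_rpow_mul_rpow {α T θ : ℝ} (hα : α ∈ Ioo (0 : ℝ) 1) (hT : 0 < T)
    (hθ : 0 < θ) : 1 / (T + θ) ≤ T ^ (-α) * θ ^ (α - 1) := by
  have h1 : T ^ α ≤ (T + θ) ^ α := Real.rpow_le_rpow hT.le (by linarith) hα.1.le
  have h2 : θ ^ (1 - α) ≤ (T + θ) ^ (1 - α) :=
    Real.rpow_le_rpow hθ.le (by linarith) (by linarith [hα.2])
  have h3 : (T + θ) ^ α * (T + θ) ^ (1 - α) = T + θ := by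
    rw [← Real.rpow_add (by linarith)]; simp
  have hTp := Real.rpow_pos_of_pos hT α
  have hθp := Real.rpow_pos_of_pos hθ (1 - α)
  rw [show α - 1 = -(1 - α) by ring, Real.rpow_neg hT.le, Real.rpow_neg hθ.le, ← mul_inv,
    ← one_div, ← h3]
  gcongr

theorem log_one_add_div_le_sSup_mul {α T θ : ℝ} (hα : α ∈ Ioo (0 : ℝ) 1) (hT : 0 < T)
    (hθ : 0 < θ) :
    Real.log (1 + T / θ) ≤
      sSup ((fun θ' => θ' ^ (1 - α) * Real.log (1 + T / θ')) '' Ioi (0 : ℝ)) * θ ^ (α - 1) := by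
  have h := le_csSup (bddAbove_rpow_mul_log_one_add_div hα hT) (mem_image_of_mem _ hθ)
  have hp := Real.rpow_pos_of_pos hθ (α - 1)
  have h1 : θ ^ (1 - α) * θ ^ (α - 1) = 1 := by
    rw [← Real.rpow_add hθ]; simp
  calc Real.log (1 + T / θ) = (θ ^ (1 - α) * Real.log (1 + T / θ)) * θ ^ (α - 1) := by
        rw [mul_right_comm, h1, one_mul]
    _ ≤ _ := mul_le_mul_of_nonneg_right h hp.le

theorem integral_one_div_add_sub {T t θ : ℝ} (hT : 0 < T) (hθ : 0 < θ) :
    ∫ s in (t - T)..t, 1 / (t + θ - s) = Real.log (1 + T / θ) := by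
  rw [intervalIntegral.integral_comp_sub_left (fun x => 1 / x) (t + θ),
    integral_one_div_of_pos (by linarith) (by linarith)]
  rw [show t + θ - (t - T) = θ + T by ring, add_sub_cancel_left, add_div, div_self hθ.ne']

/-- Convolution bound for a kernel dominated by `C / σ`: the part of the integral over
`[0, t - T]` is controlled by the `L¹` norm, the part over `[t - T, t]` by the sup norm. -/
theorem norm_integral_clm_apply_le
    {E : Type*} [NormedAddCommGroup E] [NormedSpace ℝ E]
    {A : ℝ → E →L[ℝ] E} {v : ℝ → E} {C T t θ K B : ℝ}
    (hC : 0 ≤ C) (hT : 0 < T) (ht : T ≤ t) (hθ : 0 < θ)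
    (hA : ∀ σ > (0 : ℝ), ‖A σ‖ ≤ C / σ)
    (hv : IntegrableOn (fun s => ‖v s‖) (Ioi (0 : ℝ)))
    (hK : (∫ s in Ioi (0 : ℝ), ‖v s‖) ≤ K)
    (hB : ∀ s ≥ (0 : ℝ), ‖v s‖ ≤ B) :
    ‖∫ s in (0 : ℝ)..t, A (t + θ - s) (v s)‖ ≤
      C * (K * (1 / (T + θ)) + B * Real.log (1 + T / θ)) := by
  have hB0 : 0 ≤ B := (norm_nonneg _).trans (hB 0 le_rfl)
  have h0t : 0 ≤ t := hT.le.trans ht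
  have hk : ContinuousOn (fun s => 1 / (t + θ - s)) (Icc (t - T) t) := by
    refine continuousOn_const.div (by fun_prop) fun s hs => ?_
    have := hs.2
    exact ne_of_gt (by linarith)
  have hkint : IntegrableOn (fun s => 1 / (t + θ - s)) (Ioc (t - T) t) :=
    (hk.integrableOn_compact isCompact_Icc).mono_set Ioc_subset_Icc_self
  have hsub : Ioc (t - T) t ⊆ Ioc 0 t := Ioc_subset_Ioc_left (by linarith)
  have hv' : IntegrableOn (fun s => ‖v s‖) (Ioc 0 t) := hv.mono_set Ioc_subset_Ioi_self
  have hbound : ∀ s ∈ Ioc 0 t, ‖A (t + θ - s) (v s)‖ ≤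
      C / (T + θ) * ‖v s‖ +
        C * B * (Ioc (t - T) t).indicator (fun s => 1 / (t + θ - s)) s := by
    intro s hs
    have hpos : 0 < t + θ - s := by linarith [hs.2]
    have h1 : ‖A (t + θ - s) (v s)‖ ≤ C / (t + θ - s) * ‖v s‖ :=
      (A _).le_of_opNorm_le (hA _ hpos) _
    by_cases hm : s ∈ Ioc (t - T) t
    · rw [indicator_of_mem hm]
      have h2 : C / (t + θ - s) * ‖v s‖ ≤ C / (t + θ - s) * B :=
        mul_le_mul_of_nonneg_left (hB s hs.1.le) (by positivity)
      have h3 : 0 ≤ C / (T + θ) * ‖v s‖ := by positivity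
      have h4 : C / (t + θ - s) * B = C * B * (1 / (t + θ - s)) := by ring
      linarith
    · rw [indicator_of_notMem hm, mul_zero, add_zero]
      have hs' : s ≤ t - T := by
        by_contra! h
        exact hm ⟨h, hs.2⟩
      refine h1.trans ?_
      gcongr
      linarith
  have hind : Integrable ((Ioc (t - T) t).indicator fun s => 1 / (t + θ - s))
      (volume.restrict (Ioc 0 t)) :=
    (hkint.integrable_indicator measurableSet_Ioc).restrict
  have hle : (∫ s in Ioc 0 t, ‖v s‖) ≤ K :=
    (setIntegral_mono_set hv (ae_of_all _ fun _ => norm_nonneg _)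
      Ioc_subset_Ioi_self.eventuallyLE).trans hK
  rw [intervalIntegral.integral_of_le h0t]
  calc ‖∫ s in Ioc 0 t, A (t + θ - s) (v s)‖
      ≤ ∫ s in Ioc 0 t, (C / (T + θ) * ‖v s‖ +
          C * B * (Ioc (t - T) t).indicator (fun s => 1 / (t + θ - s)) s) :=
        norm_integral_le_of_norm_le ((hv'.const_mul _).add (hind.const_mul _))
          (ae_restrict_of_forall_mem measurableSet_Ioc hbound)
    _ = C / (T + θ) * (∫ s in Ioc 0 t, ‖v s‖) + C * B * Real.log (1 + T / θ) := by
        rw [integral_add (hv'.const_mul _) (hind.const_mul _), integral_const_mul,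
          integral_const_mul, setIntegral_indicator measurableSet_Ioc,
          inter_eq_self_of_subset_right hsub,
          ← intervalIntegral.integral_of_le (by linarith : t - T ≤ t), integral_one_div_add_sub hT hθ]
    _ ≤ C / (T + θ) * K + C * B * Real.log (1 + T / θ) := by gcongr
    _ = _ := by ring


/-- θ-derivative bound for the semigroup orbit
`g(θ) = S(t+θ)u₀ + ∫₀ᵗ S(t+θ-s) f(u(s)) ds`:
`‖g'(θ)‖ ≤ C₃ ((R+K) T^{-α} + B C_{α,T}) θ^{α-1}` where
`C_{α,T} = sup_{θ>0} θ^{1-α} log(1 + T/θ)`. -/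
theorem semigroup_orbit_derivative_bound
    {E : Type*} [NormedAddCommGroup E] [NormedSpace ℝ E] [CompleteSpace E]
    (S S' : ℝ → E →L[ℝ] E) (α C₃ T t : ℝ)
    (hα : α ∈ Set.Ioo (0:ℝ) 1) (hC₃ : 0 < C₃) (hT : 0 < T) (ht : T ≤ t)
    (hS_deriv : ∀ σ > (0:ℝ), HasDerivAt S (S' σ) σ)
    (hS'_bound : ∀ σ > (0:ℝ), ‖S' σ‖ ≤ C₃ / σ)
    (R K B : ℝ) (u₀ : E) (hu₀ : ‖u₀‖ ≤ R)
    (f : E → E) (u : ℝ → E) (hu_cont : ContinuousOn u (Set.Ici (0:ℝ)))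
    (hK_int : IntegrableOn (fun s => ‖f (u s)‖) (Set.Ioi (0:ℝ)))
    (hK : (∫ s in Set.Ioi (0:ℝ), ‖f (u s)‖) ≤ K)
    (hB : ∀ s ≥ (0:ℝ), ‖f (u s)‖ ≤ B)
    (g gd : ℝ → E)
    (hg : ∀ θ : ℝ, g θ = S (t + θ) u₀ + ∫ s in (0:ℝ)..t, S (t + θ - s) (f (u s)))
    (hg_deriv : ∀ θ > (0:ℝ), HasDerivAt g (gd θ) θ)
    (hgd : ∀ θ > (0:ℝ),
      gd θ = S' (t + θ) u₀ + ∫ s in (0:ℝ)..t, S' (t + θ - s) (f (u s))) :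
    ∀ θ > (0:ℝ),
      ‖gd θ‖ ≤
        C₃ * ((R + K) * T ^ (-α) +
            B * sSup ((fun θ' => θ' ^ (1 - α) * Real.log (1 + T / θ')) '' Set.Ioi (0:ℝ)))
          * θ ^ (α - 1) := by
  intro θ hθ
  have hB0 : 0 ≤ B := (norm_nonneg _).trans (hB 0 le_rfl)
  have hR0 : 0 ≤ R := (norm_nonneg _).trans hu₀
  have hK0 : 0 ≤ K := (integral_nonneg fun _ => norm_nonneg _).trans hK
  have hinit : ‖S' (t + θ) u₀‖ ≤ C₃ * (R * (1 / (T + θ))) :=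
    calc ‖S' (t + θ) u₀‖ ≤ C₃ / (t + θ) * ‖u₀‖ :=
          (S' _).le_of_opNorm_le (hS'_bound _ (by linarith)) _
      _ ≤ C₃ / (T + θ) * R := by gcongr
      _ = _ := by ring
  have hint := norm_integral_clm_apply_le (v := fun s => f (u s)) hC₃.le hT ht hθ hS'_bound
    hK_int hK hB
  rw [hgd θ hθ]
  calc _ ≤ C₃ * ((R + K) * (1 / (T + θ)) + B * Real.log (1 + T / θ)) := by
        linarith [norm_add_le (S' (t + θ) u₀)
          (∫ s in (0:ℝ)..t, S' (t + θ - s) (f (u s)))]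
    _ ≤ C₃ * ((R + K) * (T ^ (-α) * θ ^ (α - 1)) +
          B * (sSup ((fun θ' => θ' ^ (1 - α) * Real.log (1 + T / θ')) '' Set.Ioi (0:ℝ))
            * θ ^ (α - 1))) := by
        gcongr
        · exact one_div_add_le_rpow_mul_rpow hα hT hθ
        · exact log_one_add_div_le_sSup_mul hα hT hθ
    _ = _ := by ring
end
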